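/- arXiv:1910.04276 — 2 statements merged into one kernel-verified Lean document; each statement's English description precedes it below -/
import Mathlib

section
/- Let 0 < α < 1 − √2/2 and let f be a Schwartz function on ℝ. If f(n^α) = f(-n^α) = 0 and f̂(n^α) = f̂(-n^α) = 0 for every natural number n ≥ 0, then f is identically zero. -/
open MeasureTheory

/-- The Fourier transform `f̂(ξ) = ∫_ℝ f(x) e^{2πi x ξ} dx`. -/
noncomputable def fourierTransform (f : ℝ → ℂ) (ξ : ℝ) : ℂ :=
  ∫ x : ℝ, f x * Complex.exp (2 * Real.pi * Complex.I * x * ξ)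

open Filter Topology Real
open scoped ContDiff FourierTransform SchwartzMap

/-- Iterated Rolle theorem. -/
theorem exists_iteratedDeriv_eq_zero (k : ℕ) {g : ℝ → ℝ} (hg : ContDiff ℝ ∞ g) (z : ℕ → ℝ)
    (hz : ∀ i < k, z i < z (i + 1)) (h0 : ∀ i ≤ k, g (z i) = 0) :
    ∃ ξ, iteratedDeriv k g ξ = 0 := by
  induction k generalizing g z with
  | zero => exact ⟨z 0, by simpa using h0 0 le_rfl⟩
  | succ k ih =>
    have hroll : ∀ i, i < k + 1 → ∃ c ∈ Set.Ioo (z i) (z (i + 1)), deriv g c = 0 := fun i hi =>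
      exists_deriv_eq_zero (hz i hi) hg.continuous.continuousOn
        (by rw [h0 i hi.le, h0 (i + 1) hi])
    choose! c hc hc0 using hroll
    obtain ⟨ξ, hξ⟩ := ih (contDiff_infty_iff_deriv.1 hg).2 c
      (fun i hi => (hc i (by omega)).2.trans (hc (i + 1) (by omega)).1)
      (fun i hi => hc0 i (by omega))
    exact ⟨ξ, by rwa [iteratedDeriv_succ']⟩

theorem iteratedDeriv_polynomial_eval (k : ℕ) (p : Polynomial ℝ) :
    iteratedDeriv k (fun t => p.eval t) = fun t => (Polynomial.derivative^[k] p).eval t := by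
  induction k generalizing p with
  | zero => simp
  | succ k ih =>
    rw [iteratedDeriv_succ', Function.iterate_succ_apply, ← ih]
    congr 1
    ext t
    exact p.deriv

theorem Polynomial.Monic.iterate_derivative_natDegree {R : Type*} [CommRing R]
    {p : Polynomial R} (hp : p.Monic) :
    Polynomial.derivative^[p.natDegree] p = Polynomial.C (p.natDegree.factorial : R) := by
  have hdeg := p.natDegree_iterate_derivative p.natDegree
  rw [Nat.sub_self, Nat.le_zero] at hdeg
  rw [Polynomial.eq_C_of_natDegree_eq_zero hdeg, Polynomial.coeff_iterate_derivative]
  simp [Nat.descFactorial_self, hp.coeff_natDegree]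

/-- The error bound for Lagrange interpolation at nodes to the right of `x` at which the
interpolated function vanishes. -/
theorem factorial_mul_abs_le_of_zeros {g : ℝ → ℝ} (hg : ContDiff ℝ ∞ g) {k : ℕ} {M x : ℝ}
    (hM : ∀ t, |iteratedDeriv k g t| ≤ M) {y : ℕ → ℝ} (hy : StrictMono y) (hx : x < y 0)
    (h0 : ∀ i < k, g (y i) = 0) :
    k.factorial * |g x| ≤ M * ∏ i ∈ Finset.range k, (y i - x) := by
  set p : Polynomial ℝ := ∏ i ∈ Finset.range k, (Polynomial.X - Polynomial.C (y i)) with hp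
  have hmonic : p.Monic := Polynomial.monic_prod_X_sub_C _ _
  have hdeg : p.natDegree = k := by simp [hp]
  have hroot : ∀ i < k, p.eval (y i) = 0 := fun i hi => by
    rw [hp, Polynomial.eval_prod]
    exact Finset.prod_eq_zero (Finset.mem_range.2 hi) (by simp)
  have hpC : ContDiff ℝ ∞ (fun t => p.eval t) := by simpa using p.contDiff_aeval (𝕜 := ℝ) ∞
  have hyx : ∀ i, x < y i := fun i => hx.trans_le (hy.monotone i.zero_le)
  have habs : |p.eval x| = ∏ i ∈ Finset.range k, (y i - x) := by
    rw [hp, Polynomial.eval_prod, Finset.abs_prod]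
    refine Finset.prod_congr rfl fun i _ => ?_
    simp only [Polynomial.eval_sub, Polynomial.eval_X, Polynomial.eval_C]
    rw [abs_sub_comm, abs_of_pos (sub_pos.2 (hyx i))]
  obtain ⟨ξ, hξ⟩ := exists_iteratedDeriv_eq_zero k
    (g := fun t => p.eval x * g t - g x * p.eval t)
    ((contDiff_const.mul hg).sub (contDiff_const.mul hpC))
    (fun i => Nat.casesOn i x y)
    (fun i _ => by
      cases i with
      | zero => exact hx
      | succ i => exact hy i.lt_succ_self)
    (fun i hi => by
      cases i with
      | zero => exact sub_eq_zero.2 (mul_comm _ _)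
      | succ i => simp [h0 i hi, hroot i hi])
  have hgk : ContDiffAt ℝ k g ξ := (hg.of_le (by exact_mod_cast le_top)).contDiffAt
  have hpk : ContDiffAt ℝ k (fun t => p.eval t) ξ :=
    (hpC.of_le (by exact_mod_cast le_top)).contDiffAt
  rw [iteratedDeriv_fun_sub (contDiffAt_const.mul hgk) (contDiffAt_const.mul hpk),
    iteratedDeriv_const_mul _ hgk, iteratedDeriv_const_mul _ hpk,
    iteratedDeriv_polynomial_eval] at hξ
  have hd := hmonic.iterate_derivative_natDegree
  rw [hdeg] at hd
  simp only [hd, Polynomial.eval_C, sub_eq_zero] at hξ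
  calc (k.factorial : ℝ) * |g x| = |g x * k.factorial| := by
        rw [abs_mul, Nat.abs_cast, mul_comm]
    _ = |iteratedDeriv k g ξ| * |p.eval x| := by rw [← hξ, abs_mul, mul_comm]
    _ ≤ M * |p.eval x| := by gcongr; exact hM ξ
    _ = _ := by rw [habs]

theorem factorial_mul_norm_le_of_zeros {E : Type*} [NormedAddCommGroup E] [InnerProductSpace ℝ E]
    {f : ℝ → E} (hf : ContDiff ℝ ∞ f) {k : ℕ} {M x : ℝ}
    (hM : ∀ t, ‖iteratedDeriv k f t‖ ≤ M) {y : ℕ → ℝ} (hy : StrictMono y) (hx : x < y 0)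
    (h0 : ∀ i < k, f (y i) = 0) :
    k.factorial * ‖f x‖ ≤ M * ∏ i ∈ Finset.range k, (y i - x) := by
  rcases eq_or_ne (f x) 0 with hfx | hfx
  · have hyx : ∀ i, x < y i := fun i => hx.trans_le (hy.monotone i.zero_le)
    rw [hfx, norm_zero, mul_zero]
    exact mul_nonneg ((norm_nonneg _).trans (hM 0))
      (Finset.prod_nonneg fun i _ => (sub_pos.2 (hyx i)).le)
  have hbound : ∀ t, |iteratedDeriv k (fun s => inner ℝ (f x) (f s)) t| ≤ ‖f x‖ * M := by
    intro t
    have hcomp := (innerSL ℝ (f x)).iteratedFDeriv_comp_left (x := t) hf.contDiffAt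
      (i := k) (by exact_mod_cast le_top)
    have : iteratedDeriv k (fun s => inner ℝ (f x) (f s)) t
        = inner ℝ (f x) (iteratedDeriv k f t) := by
      simp only [iteratedDeriv_eq_iteratedFDeriv]
      exact congrArg (fun m => m fun _ => 1) hcomp
    rw [this]
    exact (abs_real_inner_le_norm _ _).trans (by gcongr; exact hM t)
  have key := factorial_mul_abs_le_of_zeros (contDiff_const.inner ℝ hf) hbound hy hx
    (fun i hi => by simp [h0 i hi])
  rw [real_inner_self_eq_norm_sq, abs_of_nonneg (by positivity)] at key
  refine le_of_mul_le_mul_left ?_ (norm_pos_iff.2 hfx)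
  linarith

theorem norm_mul_pow_le_of_zeros_of_one_le {E : Type*} [NormedAddCommGroup E]
    [InnerProductSpace ℝ E] {α : ℝ} (hα0 : 0 < α) (hα1 : α ≤ 1 / 3)
    {f : ℝ → E} (hf : ContDiff ℝ ∞ f) (h0 : ∀ n : ℕ, f ((n : ℝ) ^ α) = 0) {k : ℕ} {M x : ℝ}
    (hM : ∀ t, ‖iteratedDeriv k f t‖ ≤ M) (hx : 1 ≤ x) :
    ‖f x‖ * x ^ (2 * k) ≤ 2 ^ k * M := by
  have hM0 : 0 ≤ M := (norm_nonneg _).trans (hM 0)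
  have hx0 : 0 < x := by linarith
  set N := ⌊x ^ α⁻¹⌋₊ with hN
  have hxpow : (x ^ α⁻¹) ^ α = x := Real.rpow_inv_rpow hx0.le hα0.ne'
  have hN1 : 1 ≤ N := Nat.le_floor (by simpa using Real.one_le_rpow hx (by positivity))
  have hN1' : (1 : ℝ) ≤ N := by exact_mod_cast hN1
  have hNx : (N : ℝ) ^ α ≤ x := by
    rw [← hxpow]
    exact Real.rpow_le_rpow (by positivity) (Nat.floor_le (by positivity)) hα0.le
  have hxN : x < ((N + 1 : ℕ) : ℝ) ^ α := by
    conv_lhs => rw [← hxpow]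
    push_cast
    exact Real.rpow_lt_rpow (by positivity) (Nat.lt_floor_add_one _) hα0
  set u := (N : ℝ) ^ α with hu
  have hu0 : 0 < u := by positivity
  have hu3 : u ^ 3 ≤ N := by
    rw [hu, ← Real.rpow_natCast, ← Real.rpow_mul (by positivity)]
    exact (Real.rpow_le_rpow_of_exponent_le hN1' (by push_cast; linarith)).trans_eq
      (Real.rpow_one _)
  have hstep : ∀ s : ℝ, 0 ≤ s → ((N : ℝ) + s) ^ α ≤ u + u * (α * (s / N)) := by
    intro s hs
    have : (N : ℝ) + s = N * (1 + s / N) := by field_simp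
    rw [this, Real.mul_rpow (by positivity) (by positivity)]
    have := rpow_one_add_le_one_add_mul_self (s := s / N) (by
      have : 0 ≤ s / N := by positivity
      linarith) hα0.le (by linarith)
    nlinarith
  have hx2u : x ≤ 2 * u := by
    refine hxN.le.trans ?_
    push_cast
    refine (hstep 1 zero_le_one).trans ?_
    have : (1 : ℝ) / N ≤ 1 := (div_le_one (by positivity)).2 hN1'
    have : α * (1 / N) ≤ 1 := by nlinarith [show (0 : ℝ) ≤ 1 / N by positivity]
    nlinarith
  have hgap : u * (α / N) ≤ 2 / x ^ 2 := by
    rw [mul_div, div_le_div_iff₀ (by positivity) (by positivity)]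
    have h1 : x ^ 2 ≤ 4 * u ^ 2 := by nlinarith
    calc u * α * x ^ 2 ≤ u * (1 / 3 : ℝ) * (4 * u ^ 2) := by gcongr
      _ ≤ 2 * (N : ℝ) := by nlinarith
  have hy : StrictMono fun i : ℕ => ((N + 1 + i : ℕ) : ℝ) ^ α := fun i j hij =>
    Real.rpow_lt_rpow (by positivity) (by exact_mod_cast (by omega)) hα0
  have key := factorial_mul_norm_le_of_zeros hf hM hy (by simpa using hxN)
    (fun i _ => h0 _)
  have hprod : ∏ i ∈ Finset.range k, (((N + 1 + i : ℕ) : ℝ) ^ α - x)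
      ≤ k.factorial * (2 / x ^ 2) ^ k := by
    rw [← Finset.prod_range_add_one_eq_factorial, Nat.cast_prod,
      ← Finset.card_range k, ← Finset.prod_const, Finset.card_range, ← Finset.prod_mul_distrib]
    refine Finset.prod_le_prod (fun i _ => ?_) fun i _ => ?_
    · exact sub_nonneg.2 (hxN.le.trans (hy.monotone (Nat.zero_le i)))
    · have h1 := hstep (i + 1) (by positivity)
      have h2 : ((N + 1 + i : ℕ) : ℝ) = N + (i + 1) := by push_cast; ring
      have h3 : u * (α * (((i : ℝ) + 1) / N)) = (i + 1) * (u * (α / N)) := by ring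
      rw [h2]
      push_cast
      have h4 : ((i : ℝ) + 1) * (u * (α / N)) ≤ (i + 1) * (2 / x ^ 2) := by gcongr
      linarith
  have hfin : ‖f x‖ ≤ M * (2 / x ^ 2) ^ k := by
    have hk : (0 : ℝ) < k.factorial := by positivity
    refine le_of_mul_le_mul_left (key.trans ?_) hk
    calc _ ≤ M * (k.factorial * (2 / x ^ 2) ^ k) := by gcongr
      _ = _ := by ring
  calc ‖f x‖ * x ^ (2 * k) ≤ M * (2 / x ^ 2) ^ k * x ^ (2 * k) := by gcongr
    _ = 2 ^ k * M := by rw [div_pow, ← pow_mul]; field_simp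

theorem norm_mul_pow_le_of_zeros {E : Type*} [NormedAddCommGroup E]
    [InnerProductSpace ℝ E] {α : ℝ} (hα0 : 0 < α) (hα1 : α ≤ 1 / 3)
    {f : ℝ → E} (hf : ContDiff ℝ ∞ f)
    (h0 : ∀ n : ℕ, f ((n : ℝ) ^ α) = 0 ∧ f (-(n : ℝ) ^ α) = 0) {k : ℕ} {M x : ℝ}
    (hM : ∀ t, ‖iteratedDeriv k f t‖ ≤ M) (hx : 1 ≤ |x|) :
    ‖f x‖ * |x| ^ (2 * k) ≤ 2 ^ k * M := by
  rcases le_total 0 x with hx0 | hx0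
  · rw [abs_of_nonneg hx0] at hx ⊢
    exact norm_mul_pow_le_of_zeros_of_one_le hα0 hα1 hf (fun n => (h0 n).1) hM hx
  · rw [abs_of_nonpos hx0] at hx ⊢
    have := norm_mul_pow_le_of_zeros_of_one_le hα0 hα1 (f := fun t => f (-t))
      (hf.comp contDiff_neg) (fun n => (h0 n).2) (k := k) (M := M)
      (fun t => by simpa [iteratedDeriv_comp_neg, norm_smul] using hM (-t)) hx
    simpa using this

theorem eq_zero_of_zeros_of_iteratedDeriv_le {E : Type*} [NormedAddCommGroup E]
    [InnerProductSpace ℝ E] {α : ℝ} (hα0 : 0 < α) (hα1 : α ≤ 1 / 3)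
    {f : ℝ → E} (hf : ContDiff ℝ ∞ f) (h0 : ∀ n : ℕ, f ((n : ℝ) ^ α) = 0)
    {C : ℝ} (hC : 0 ≤ C) {κ : ℕ → ℕ} (hκ : Tendsto κ atTop atTop)
    (hb : ∀ j t, ‖iteratedDeriv (κ j) f t‖ ≤ C ^ κ j) (x : ℝ) : f x = 0 := by
  have hlarge : ∀ t, 2 * C + 1 ≤ t → f t = 0 := by
    intro t ht
    have ht1 : 1 ≤ t := by linarith
    have hr : 2 * C / t ^ 2 < 1 := by
      rw [div_lt_one (by positivity)]
      nlinarith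
    have hlim := (tendsto_pow_atTop_nhds_zero_of_lt_one (by positivity) hr).comp hκ
    refine norm_le_zero_iff.1 (ge_of_tendsto' hlim fun j => ?_)
    have key := norm_mul_pow_le_of_zeros_of_one_le hα0 hα1 hf h0 (hb j) ht1
    rw [Function.comp_apply, div_pow, ← pow_mul, le_div_iff₀ (by positivity), mul_pow]
    exact key
  set L := 2 * C + 1 with hL
  rcases le_or_gt L x with hx | hx
  · exact hlarge x hx
  let y : ℕ → ℝ := fun i => L + 1 - 1 / ((i : ℝ) + 1)
  have hy : StrictMono y := fun i j hij =>
    sub_lt_sub_left (one_div_lt_one_div_of_lt (by positivity) (by gcongr)) _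
  have hy0 : y 0 = L := by simp [y]
  have hLy : ∀ i, L ≤ y i := fun i => hy0 ▸ hy.monotone i.zero_le
  have hyL : ∀ i, y i ≤ L + 1 := fun i => sub_le_self _ (by positivity)
  have hlim := (FloorSemiring.tendsto_pow_div_factorial_atTop (C * (L + 1 - x))).comp hκ
  refine norm_le_zero_iff.1 (ge_of_tendsto' hlim fun j => ?_)
  have key := factorial_mul_norm_le_of_zeros hf (hb j) hy (hy0.symm ▸ hx)
    (fun i _ => hlarge _ (hLy i))
  rw [Function.comp_apply, le_div_iff₀ (by positivity), mul_pow, mul_comm]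
  refine key.trans ?_
  gcongr
  refine (Finset.prod_le_prod (fun i _ => by linarith [hLy i]) fun i _ =>
    sub_le_sub_right (hyL i) x).trans_eq ?_
  simp

/-- The `k`-th absolute moment of a Schwartz function. -/
noncomputable def absMoment (k : ℕ) (φ : 𝓢(ℝ, ℂ)) : ℝ :=
  ∫ x, |x| ^ k * ‖φ x‖

theorem absMoment_nonneg (k : ℕ) (φ : 𝓢(ℝ, ℂ)) : 0 ≤ absMoment k φ :=
  integral_nonneg fun _ => by positivity

theorem norm_iteratedDeriv_fourier_le (k : ℕ) (φ : 𝓢(ℝ, ℂ)) (t : ℝ) :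
    ‖iteratedDeriv k (𝓕 φ : 𝓢(ℝ, ℂ)) t‖ ≤ (2 * π) ^ k * absMoment k φ := by
  have hmom : ∀ n : ℕ, (n : ℕ∞) ≤ ⊤ → Integrable fun x : ℝ => x ^ n • φ x := fun n _ => by
    refine (integrable_norm_iff ?_).1 ?_
    · exact (by fun_prop : Continuous fun x : ℝ => x ^ n • φ x).aestronglyMeasurable
    · simpa [norm_smul] using φ.integrable_pow_mul volume n
  rw [SchwartzMap.fourier_coe, Real.iteratedDeriv_fourier hmom le_top,
    Real.fourier_real_eq_integral_exp_smul, absMoment, ← integral_const_mul]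
  refine (norm_integral_le_integral_norm _).trans_eq (integral_congr_ae (.of_forall fun x => ?_))
  simp only [norm_smul, Complex.norm_exp_ofReal_mul_I]
  simp [abs_of_pos Real.pi_pos, mul_pow, mul_assoc]

theorem absMoment_fourier_le {α : ℝ} (hα0 : 0 < α) (hα1 : α ≤ 1 / 3) {φ ψ : 𝓢(ℝ, ℂ)}
    (hψ : 𝓕 φ = ψ) (h0 : ∀ n : ℕ, ψ ((n : ℝ) ^ α) = 0 ∧ ψ (-(n : ℝ) ^ α) = 0) (k : ℕ) :
    absMoment (2 * k) ψ ≤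
      absMoment 0 ψ + 2 * π * (4 * π) ^ (k + 1) * absMoment (k + 1) φ := by
  set M := (2 * π) ^ (k + 1) * absMoment (k + 1) φ with hM
  have hM0 : 0 ≤ M := mul_nonneg (by positivity) (absMoment_nonneg _ _)
  have hpt : ∀ x, |x| ^ (2 * k) * ‖ψ x‖ ≤
      |x| ^ 0 * ‖ψ x‖ + 2 * 2 ^ (k + 1) * M * (1 + x ^ 2)⁻¹ := by
    intro x
    rcases le_total |x| 1 with hx | hx
    · have h1 : |x| ^ (2 * k) * ‖ψ x‖ ≤ |x| ^ 0 * ‖ψ x‖ := by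
        rw [pow_zero]
        gcongr
        exact pow_le_one₀ (abs_nonneg x) hx
      have h2 : 0 ≤ 2 * 2 ^ (k + 1) * M * (1 + x ^ 2)⁻¹ := by positivity
      linarith
    · have key := norm_mul_pow_le_of_zeros hα0 hα1 (ψ.smooth ⊤) h0
        (fun t => hψ ▸ norm_iteratedDeriv_fourier_le (k + 1) φ t) hx
      have h1 : |x| ^ (2 * k) * ‖ψ x‖ ≤ 2 * 2 ^ (k + 1) * M * (1 + x ^ 2)⁻¹ := by
        rw [← div_eq_mul_inv, le_div_iff₀ (by positivity)]
        have hx2 : 1 + x ^ 2 ≤ 2 * |x| ^ 2 := by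
          rw [← sq_abs x]
          nlinarith
        calc |x| ^ (2 * k) * ‖ψ x‖ * (1 + x ^ 2)
            ≤ |x| ^ (2 * k) * ‖ψ x‖ * (2 * |x| ^ 2) := by gcongr
          _ = 2 * (‖ψ x‖ * |x| ^ (2 * (k + 1))) := by ring
          _ ≤ 2 * (2 ^ (k + 1) * M) := by gcongr
          _ = _ := by ring
      exact h1.trans (le_add_of_nonneg_left (by positivity))
  have hmom : ∀ n, Integrable fun x : ℝ => |x| ^ n * ‖ψ x‖ := fun n => by
    simpa using ψ.integrable_pow_mul volume n
  have hdecay := integrable_inv_one_add_sq.const_mul (2 * 2 ^ (k + 1) * M)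
  refine (integral_mono (hmom _) ((hmom 0).add hdecay) hpt).trans_eq ?_
  rw [integral_add' (hmom 0) hdecay, integral_const_mul, integral_univ_inv_one_add_sq, absMoment,
    hM, show (4 * π) = 2 * (2 * π) by ring, mul_pow 2 (2 * π)]
  ring

theorem exists_le_pow_of_doubling {a : ℕ → ℝ} (ha : ∀ k, 0 ≤ a k) {A K : ℝ} (hA : 0 ≤ A)
    (hK : 1 ≤ K) (h : ∀ k, a (2 * k) ≤ A + K ^ (k + 2) * a (k + 1)) :
    ∃ D, 1 ≤ D ∧ ∀ j : ℕ, a (2 ^ j + 2) ≤ D ^ 2 ^ j := by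
  have ha3 := ha 3
  have hK3 : 1 ≤ K ^ 4 := one_le_pow₀ hK
  refine ⟨A + 1 + K ^ 4 + a 3, by linarith, fun j => ?_⟩
  set D := A + 1 + K ^ 4 + a 3 with hD
  have hD1 : 1 ≤ D := by linarith
  induction j with
  | zero => norm_num; linarith
  | succ j ih =>
    have hc : 1 ≤ 2 ^ j := Nat.one_le_two_pow
    rw [show 2 ^ (j + 1) + 2 = 2 * (2 ^ j + 1) by ring, pow_succ, pow_mul]
    generalize 2 ^ j = c at *
    have hA1 : A ≤ (A + 1) ^ c := by
      linarith [le_self_pow₀ (by linarith : 1 ≤ A + 1) (by omega : c ≠ 0)]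
    have hKc : K ^ (c + 1 + 2) ≤ (K ^ 4) ^ c := by
      rw [← pow_mul]
      exact pow_le_pow_right₀ hK (by omega)
    have hDc : 1 ≤ D ^ c := one_le_pow₀ hD1
    calc a (2 * (c + 1)) ≤ A + K ^ (c + 1 + 2) * a (c + 1 + 1) := h (c + 1)
      _ ≤ (A + 1) ^ c * D ^ c + (K ^ 4) ^ c * D ^ c := by
        gcongr
        · exact hA1.trans (le_mul_of_one_le_right (by positivity) hDc)
        · exact ha _
      _ = ((A + 1) ^ c + (K ^ 4) ^ c) * D ^ c := by ring
      _ ≤ D ^ c * D ^ c := by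
        gcongr
        refine (pow_add_pow_le (by linarith) (by positivity) (by omega)).trans ?_
        gcongr
        linarith
      _ = (D ^ c) ^ 2 := by ring

theorem fourierTransform_eq_fourier_neg (f : ℝ → ℂ) (ξ : ℝ) :
    fourierTransform f ξ = 𝓕 f (-ξ) := by
  rw [Real.fourier_real_eq_integral_exp_smul, fourierTransform]
  refine integral_congr_ae (.of_forall fun x => ?_)
  simp only [smul_eq_mul]
  rw [mul_comm]
  congr 2
  push_cast
  ring

theorem absMoment_fourierInv (k : ℕ) (f : 𝓢(ℝ, ℂ)) :
    absMoment k (𝓕⁻ f) = absMoment k (𝓕 f) := by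
  rw [absMoment, ← integral_neg_eq_self]
  refine integral_congr_ae (.of_forall fun x => ?_)
  simp [SchwartzMap.fourierInv_apply_eq]

/-- If a Schwartz function and its Fourier transform both vanish at all `±n ^ α`, then, along a
sequence of orders, their absolute moments grow at most geometrically. -/
theorem exists_absMoment_le_pow {α : ℝ} (hα0 : 0 < α) (hα1 : α ≤ 1 / 3) (f : 𝓢(ℝ, ℂ))
    (hf : ∀ n : ℕ, f ((n : ℝ) ^ α) = 0 ∧ f (-(n : ℝ) ^ α) = 0)
    (hg : ∀ n : ℕ, (𝓕 f : 𝓢(ℝ, ℂ)) ((n : ℝ) ^ α) = 0 ∧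
      (𝓕 f : 𝓢(ℝ, ℂ)) (-(n : ℝ) ^ α) = 0) :
    ∃ D, 1 ≤ D ∧ ∀ j : ℕ, absMoment (2 ^ j + 2) (𝓕 f) ≤ D ^ 2 ^ j := by
  have hinv : 𝓕 (𝓕⁻ f) = f := FourierTransform.fourier_fourierInv_eq f
  have hpi : 1 ≤ π := by linarith [Real.two_le_pi]
  have hpow : ∀ k : ℕ, 2 * π * (4 * π) ^ (k + 1) ≤ (4 * π) ^ (k + 2) := fun k => by
    rw [pow_succ _ (k + 1), mul_comm]
    gcongr
    norm_num
  obtain ⟨D, hD1, hD⟩ := exists_le_pow_of_doubling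
    (a := fun k => max (absMoment k f) (absMoment k (𝓕 f)))
    (fun k => (absMoment_nonneg k f).trans (le_max_left _ _))
    (A := max (absMoment 0 f) (absMoment 0 (𝓕 f))) (K := 4 * π)
    ((absMoment_nonneg 0 f).trans (le_max_left _ _)) (by linarith) (fun k => by
      refine max_le ?_ ?_
      · refine (absMoment_fourier_le hα0 hα1 hinv hf k).trans ?_
        rw [absMoment_fourierInv]
        gcongr
        · exact le_max_left _ _
        · exact absMoment_nonneg _ _
        · exact hpow k
        · exact le_max_right _ _
      · refine (absMoment_fourier_le hα0 hα1 rfl hg k).trans ?_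
        gcongr
        · exact le_max_right _ _
        · exact absMoment_nonneg _ _
        · exact hpow k
        · exact le_max_left _ _)
  exact ⟨D, hD1, fun j => (le_max_right _ _).trans (hD j)⟩

theorem uniqueness_diagonal (α : ℝ) (hα0 : 0 < α) (hα1 : α < 1 - Real.sqrt 2 / 2)
    (f : SchwartzMap ℝ ℂ)
    (hf : ∀ n : ℕ, f ((n : ℝ) ^ α) = 0 ∧ f (-(n : ℝ) ^ α) = 0)
    (hfhat : ∀ n : ℕ, fourierTransform f ((n : ℝ) ^ α) = 0 ∧
      fourierTransform f (-(n : ℝ) ^ α) = 0) :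
    ∀ x : ℝ, f x = 0 := by
  have hα3 : α ≤ 1 / 3 := by
    have : (4 / 3 : ℝ) ≤ √2 := Real.le_sqrt_of_sq_le (by norm_num)
    linarith
  have hg : ∀ n : ℕ, (𝓕 f : 𝓢(ℝ, ℂ)) ((n : ℝ) ^ α) = 0 ∧
      (𝓕 f : 𝓢(ℝ, ℂ)) (-(n : ℝ) ^ α) = 0 := fun n => by
    have := hfhat n
    rw [fourierTransform_eq_fourier_neg, fourierTransform_eq_fourier_neg, neg_neg] at this
    exact this.symm
  have hinv : 𝓕 (𝓕⁻ f) = f := FourierTransform.fourier_fourierInv_eq f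
  obtain ⟨D, hD1, hD⟩ := exists_absMoment_le_pow hα0 hα3 f hf hg
  refine eq_zero_of_zeros_of_iteratedDeriv_le hα0 hα3 (f.smooth ⊤) (fun n => (hf n).1)
    (C := 2 * π * D) (κ := fun j => 2 ^ j + 2) (by positivity)
    (tendsto_atTop_mono (fun j => Nat.lt_two_pow_self.le.trans (Nat.le_add_right _ 2)) tendsto_id)
    fun j t => ?_
  have hder := norm_iteratedDeriv_fourier_le (2 ^ j + 2) (𝓕⁻ f) t
  rw [hinv, absMoment_fourierInv] at hder
  rw [mul_pow]
  refine hder.trans ?_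
  gcongr
  exact (hD j).trans (pow_le_pow_right₀ hD1 (by omega))
end

section
/- Let 0 < α < 1 and let f be a Schwartz function on ℝ with f(n^α) = f(-n^α) = 0 for every natural number n ≥ 0. Then for every natural number k ≥ 1 and every x with |x| > (2k+1)^α, one has |f(x)| ≤ (k+1)! (2^{2−α} π)^{k+1} α^k I_k(f̂) |x|^{k(α−1)/α}, where I_k(f̂) = ∫_ℝ |f̂(y)| |y|^k dy. -/
open MeasureTheory

/-- The weighted integral `I_k(g) = ∫_ℝ |g(y)| |y|^k dy`. -/
noncomputable def weightedIntegral (g : ℝ → ℂ) (k : ℕ) : ℝ :=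
  ∫ y : ℝ, ‖g y‖ * |y| ^ k

/-- A smooth function vanishing at `k` points `a 0 > a 1 > ⋯` to the left of `x`, with `k`-th
derivative bounded by `M`, is bounded at `x` by `M` times the product of the distances. -/
theorem abs_le_mul_prod_sub_of_zeros {M : ℝ} (k : ℕ) {g : ℝ → ℝ} (hg : ContDiff ℝ k g)
    (hM : ∀ t, |iteratedDeriv k g t| ≤ M) {a : ℕ → ℝ} (ha : ∀ i, i + 1 < k → a (i + 1) < a i)
    (hz : ∀ i < k, g (a i) = 0) {x : ℝ} (hx : ∀ i < k, a i ≤ x) :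
    |g x| ≤ M * ∏ i ∈ Finset.range k, (x - a i) := by
  induction k generalizing g a x with
  | zero => simpa using hM x
  | succ k ih =>
    have hM0 : 0 ≤ M := (abs_nonneg _).trans (hM 0)
    have hd : Differentiable ℝ g := hg.differentiable (by simp)
    have hrolle : ∀ i, ∃ b, i < k → a (i + 1) < b ∧ b < a i ∧ deriv g b = 0 := by
      intro i
      by_cases hi : i < k
      · obtain ⟨b, hb, hb0⟩ := exists_deriv_eq_zero (ha i (by lia)) hd.continuous.continuousOn
          ((hz (i + 1) (by lia)).trans (hz i (by lia)).symm)
        exact ⟨b, fun _ => ⟨hb.1, hb.2, hb0⟩⟩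
      · exact ⟨0, fun h => absurd h hi⟩
    choose b hb using hrolle
    have hx0 : a 0 ≤ x := hx 0 k.succ_pos
    have ha0 : ∀ i < k, a (i + 1) < a 0 := by
      intro i hi
      induction i with
      | zero => exact ha 0 (by lia)
      | succ i ihi => exact (ha (i + 1) (by lia)).trans (ihi (by lia))
    have hb_le : ∀ i < k, b i ≤ a 0 := by
      intro i hi
      rcases i with _ | i
      · exact (hb 0 hi).2.1.le
      · exact ((hb (i + 1) hi).2.1.trans (ha0 i (by lia))).le
    have hderiv : ∀ t ∈ Set.Icc (a 0) x,
        ‖deriv g t‖ ≤ M * ∏ i ∈ Finset.range k, (x - a (i + 1)) := by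
      intro t ht
      refine (ih (g := deriv g) (a := b) (x := t) ?_ ?_ ?_ ?_ ?_).trans ?_
      · exact ((contDiff_succ_iff_deriv (n := k)).1 (by exact_mod_cast hg)).2.2
      · intro t
        rw [← iteratedDeriv_succ']
        exact hM t
      · intro i hi
        exact (hb (i + 1) hi).2.1.trans (hb i (by lia)).1
      · exact fun i hi => (hb i hi).2.2
      · exact fun i hi => (hb_le i hi).trans ht.1
      · refine mul_le_mul_of_nonneg_left (Finset.prod_le_prod ?_ ?_) hM0
        · intro i hi
          exact sub_nonneg.2 ((hb_le i (Finset.mem_range.1 hi)).trans ht.1)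
        · intro i hi
          exact sub_le_sub ht.2 (hb i (Finset.mem_range.1 hi)).1.le
    have hmv := (convex_Icc (a 0) x).norm_image_sub_le_of_norm_deriv_le
      (fun t _ => hd t) hderiv (Set.left_mem_Icc.2 hx0) (Set.right_mem_Icc.2 hx0)
    rw [hz 0 k.succ_pos, sub_zero, Real.norm_eq_abs, Real.norm_eq_abs,
      abs_of_nonneg (sub_nonneg.2 hx0)] at hmv
    rwa [Finset.prod_range_succ', ← mul_assoc]

/-- The complex-valued version of `abs_le_mul_prod_sub_of_zeros`. -/
theorem norm_le_mul_prod_sub_of_zeros {M : ℝ} (k : ℕ) {h : ℝ → ℂ} (hh : ContDiff ℝ k h)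
    (hM : ∀ t, ‖iteratedDeriv k h t‖ ≤ M) {a : ℕ → ℝ} (ha : ∀ i, i + 1 < k → a (i + 1) < a i)
    (hz : ∀ i < k, h (a i) = 0) {x : ℝ} (hx : ∀ i < k, a i ≤ x) :
    ‖h x‖ ≤ M * ∏ i ∈ Finset.range k, (x - a i) := by
  obtain ⟨L, hL, hLx⟩ := exists_dual_vector'' ℝ (h x)
  have hLd : ∀ t, iteratedDeriv k (L ∘ h) t = L (iteratedDeriv k h t) := by
    intro t
    rw [iteratedDeriv, iteratedDeriv, L.iteratedFDeriv_comp_left hh.contDiffAt le_rfl]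
    rfl
  have := abs_le_mul_prod_sub_of_zeros (M := M) k (g := L ∘ h) (L.contDiff.comp hh) ?_ ha
    (fun i hi => by simp [hz i hi]) hx
  · simpa [hLx] using this
  · intro t
    rw [hLd, ← Real.norm_eq_abs]
    refine (L.le_opNorm _).trans ((mul_le_of_le_one_left (norm_nonneg _) hL).trans (hM t))

/-- The tangent line bound for the concave function `t ↦ t ^ α`. -/
theorem rpow_sub_rpow_le {α : ℝ} (hα0 : 0 < α) (hα1 : α < 1) {m y : ℝ} (hm : 0 < m)
    (hmy : m ≤ y) : y ^ α - m ^ α ≤ α * m ^ (α - 1) * (y - m) := by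
  have h1 := rpow_one_add_le_one_add_mul_self (s := y / m - 1) (p := α)
    (by linarith [div_nonneg (hm.le.trans hmy) hm.le]) hα0.le hα1.le
  rw [add_sub_cancel, Real.div_rpow (hm.le.trans hmy) hm.le,
    div_le_iff₀ (Real.rpow_pos_of_pos hm α)] at h1
  rw [Real.rpow_sub_one hm.ne']
  calc y ^ α - m ^ α ≤ (1 + α * (y / m - 1)) * m ^ α - m ^ α := by linarith
    _ = α * (m ^ α / m) * (y - m) := by field_simp; ring

/-- Decay at `x > 0` of a function vanishing at all the points `n ^ α`, in terms of a bound on its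
`k`-th derivative. -/
theorem norm_le_of_zeros_rpow {α : ℝ} (hα0 : 0 < α) (hα1 : α < 1) {M : ℝ} (k : ℕ) {h : ℝ → ℂ}
    (hh : ContDiff ℝ k h) (hM : ∀ t, ‖iteratedDeriv k h t‖ ≤ M)
    (hz : ∀ n : ℕ, h ((n : ℝ) ^ α) = 0) {x : ℝ} (hx : (2 * (k : ℝ) + 1) ^ α < x) :
    ‖h x‖ ≤ M * ((Nat.factorial k : ℝ) * ((2 : ℝ) ^ (1 - α)) ^ k * α ^ k *
      x ^ ((k : ℝ) * (α - 1) / α)) := by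
  have hM0 : 0 ≤ M := (norm_nonneg _).trans (hM 0)
  have hx0 : 0 < x := (Real.rpow_pos_of_pos (by positivity) α).trans hx
  obtain ⟨y, hy0, rfl⟩ : ∃ y, 0 < y ∧ x = y ^ α :=
    ⟨x ^ α⁻¹, Real.rpow_pos_of_pos hx0 _, (Real.rpow_inv_rpow hx0.le hα0.ne').symm⟩
  have hy : 2 * (k : ℝ) + 1 < y := (Real.rpow_lt_rpow_iff (by positivity) hy0.le hα0).1 hx
  set N := ⌊y⌋₊ with hN
  have hNy : (N : ℝ) ≤ y := Nat.floor_le hy0.le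
  have hyN : y < N + 1 := Nat.lt_floor_add_one y
  have hkN : 2 * k + 1 ≤ N := Nat.le_floor (by push_cast; exact hy.le)
  have hcast : ∀ i < k, ((N - i : ℕ) : ℝ) = N - i := fun i hi => Nat.cast_sub (by lia)
  have hle : ∀ i < k, ((N - i : ℕ) : ℝ) ≤ y := fun i hi => by
    rw [hcast i hi]
    linarith [Nat.cast_nonneg (α := ℝ) i]
  refine (norm_le_mul_prod_sub_of_zeros k hh hM (a := fun i => ((N - i : ℕ) : ℝ) ^ α) ?_
    (fun i _ => hz _) ?_).trans (mul_le_mul_of_nonneg_left ?_ hM0)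
  · intro i hi
    exact Real.rpow_lt_rpow (Nat.cast_nonneg _) (Nat.cast_lt.2 (by lia)) hα0
  · exact fun i hi => Real.rpow_le_rpow (Nat.cast_nonneg _) (hle i hi) hα0.le
  calc ∏ i ∈ Finset.range k, (y ^ α - ((N - i : ℕ) : ℝ) ^ α)
      ≤ ∏ i ∈ Finset.range k, ((2 : ℝ) ^ (1 - α) * α * y ^ (α - 1) * ((i + 1 : ℕ) : ℝ)) := by
        refine Finset.prod_le_prod (fun i hi => ?_) (fun i hi => ?_)
        · exact sub_nonneg.2 (Real.rpow_le_rpow (Nat.cast_nonneg _)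
            (hle i (Finset.mem_range.1 hi)) hα0.le)
        · have hi := Finset.mem_range.1 hi
          have hik : (i : ℝ) + 1 ≤ k := by exact_mod_cast hi
          have hhalf : y / 2 ≤ ((N - i : ℕ) : ℝ) := by
            rw [hcast i hi]
            linarith
          have hm : 0 < ((N - i : ℕ) : ℝ) := (by positivity : 0 < y / 2).trans_le hhalf
          refine (rpow_sub_rpow_le hα0 hα1 hm (hle i hi)).trans ?_
          have h1 : ((N - i : ℕ) : ℝ) ^ (α - 1) ≤ (2 : ℝ) ^ (1 - α) * y ^ (α - 1) := by
            refine (Real.rpow_le_rpow_of_nonpos (by positivity) hhalf (by linarith)).trans_eq ?_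
            rw [Real.div_rpow hy0.le two_pos.le, ← neg_sub α 1, Real.rpow_neg two_pos.le]
            ring
          have h2 : y - ((N - i : ℕ) : ℝ) ≤ ((i + 1 : ℕ) : ℝ) := by
            rw [hcast i hi]
            push_cast
            linarith
          calc α * ((N - i : ℕ) : ℝ) ^ (α - 1) * (y - ((N - i : ℕ) : ℝ))
              ≤ α * ((2 : ℝ) ^ (1 - α) * y ^ (α - 1)) * ((i + 1 : ℕ) : ℝ) := by
                have := sub_nonneg.2 (hle i hi)
                gcongr
            _ = _ := by ring
    _ = _ := by
        rw [Finset.prod_mul_distrib, Finset.prod_const, Finset.card_range, ← Nat.cast_prod,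
          Finset.prod_range_add_one_eq_factorial, mul_pow, mul_pow, ← Real.rpow_mul hy0.le,
          ← Real.rpow_mul_natCast hy0.le]
        have : α * ((k : ℝ) * (α - 1) / α) = (α - 1) * k := by field_simp
        rw [this]
        ring

theorem fourierTransform_eq_fourierInv (f : SchwartzMap ℝ ℂ) :
    fourierTransform f = FourierTransformInv.fourierInv f := by
  ext ξ
  rw [SchwartzMap.fourierInv_coe, Real.fourierInv_eq', fourierTransform]
  refine integral_congr_ae (.of_forall fun x => ?_)
  simp only [smul_eq_mul, RCLike.inner_apply, conj_trivial]
  rw [mul_comm]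
  congr 2
  push_cast
  ring

theorem norm_iteratedDeriv_le_weightedIntegral (f : SchwartzMap ℝ ℂ) (k : ℕ) (t : ℝ) :
    ‖iteratedDeriv k f t‖ ≤ (2 * Real.pi) ^ k * weightedIntegral (fourierTransform f) k := by
  rw [fourierTransform_eq_fourierInv]
  set F : SchwartzMap ℝ ℂ := FourierTransformInv.fourierInv f with hF
  have hf : (f : ℝ → ℂ) = FourierTransform.fourier (F : ℝ → ℂ) := by
    rw [← SchwartzMap.fourier_coe, hF, FourierTransform.fourier_fourierInv_eq]
  have hint : ∀ n : ℕ, Integrable (fun x : ℝ => x ^ n • F x) := by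
    intro n
    refine (F.integrable_pow_mul volume n).mono' (by fun_prop) (.of_forall fun x => ?_)
    simp
  rw [hf, Real.iteratedDeriv_fourier (N := ⊤) (n := k) (fun n _ => hint n) le_top,
    Real.fourier_eq, weightedIntegral, ← integral_const_mul]
  refine (norm_integral_le_integral_norm _).trans_eq (integral_congr_ae (.of_forall fun x => ?_))
  simp [mul_pow, abs_of_pos Real.pi_pos]
  ring

theorem function_decay_from_power_zeros (α : ℝ) (hα0 : 0 < α) (hα1 : α < 1)
    (f : SchwartzMap ℝ ℂ)
    (hf : ∀ n : ℕ, f ((n : ℝ) ^ α) = 0 ∧ f (-(n : ℝ) ^ α) = 0) :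
    ∀ k : ℕ, 1 ≤ k → ∀ x : ℝ, (2 * (k : ℝ) + 1) ^ α < |x| →
      ‖f x‖ ≤ (Nat.factorial (k + 1) : ℝ) *
        ((2 : ℝ) ^ (2 - α) * Real.pi) ^ (k + 1) * α ^ k *
        weightedIntegral (fourierTransform f) k *
        |x| ^ ((k : ℝ) * (α - 1) / α) := by
  intro k _ x hx
  have hI : 0 ≤ weightedIntegral (fourierTransform f) k :=
    integral_nonneg fun y => by positivity
  have hsmooth : ContDiff ℝ k f := f.smooth k
  have hbound : ‖f x‖ ≤ (2 * Real.pi) ^ k * weightedIntegral (fourierTransform f) k *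
      ((Nat.factorial k : ℝ) * ((2 : ℝ) ^ (1 - α)) ^ k * α ^ k *
        |x| ^ ((k : ℝ) * (α - 1) / α)) := by
    rcases le_total 0 x with h | h
    · rw [abs_of_nonneg h] at hx ⊢
      exact norm_le_of_zeros_rpow hα0 hα1 k hsmooth
        (norm_iteratedDeriv_le_weightedIntegral f k) (fun n => (hf n).1) hx
    · rw [abs_of_nonpos h] at hx ⊢
      have hM : ∀ t, ‖iteratedDeriv k (fun s => f (-s)) t‖ ≤
          (2 * Real.pi) ^ k * weightedIntegral (fourierTransform f) k := by
        intro t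
        rw [iteratedDeriv_comp_neg, norm_smul]
        simpa using norm_iteratedDeriv_le_weightedIntegral f k (-t)
      simpa only [Function.comp_apply, neg_neg] using norm_le_of_zeros_rpow hα0 hα1 k
        (hsmooth.comp contDiff_neg) hM (fun n => (hf n).2) hx
  have htwo : (2 : ℝ) ^ (2 - α) = 2 * 2 ^ (1 - α) := by
    rw [← Real.rpow_one_add' two_pos.le (by linarith)]
    congr 1
    ring
  have hbase : 1 ≤ (2 : ℝ) ^ (2 - α) * Real.pi :=
    one_le_mul_of_one_le_of_one_le (Real.one_le_rpow one_le_two (by linarith))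
      (by linarith [Real.pi_gt_three])
  calc ‖f x‖ ≤ _ := hbound
    _ = (Nat.factorial k : ℝ) * ((2 : ℝ) ^ (2 - α) * Real.pi) ^ k * α ^ k *
        weightedIntegral (fourierTransform f) k * |x| ^ ((k : ℝ) * (α - 1) / α) := by
      rw [htwo, mul_pow, mul_pow, mul_pow]
      ring
    _ ≤ _ := by
      gcongr ?_ * ?_ * _ * _ * _
      · exact_mod_cast Nat.factorial_le k.le_succ
      · exact pow_le_pow_right₀ hbase k.le_succ
end
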